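/- arXiv:2210.12575 — 4 statements merged into one kernel-verified Lean document; each statement's English description precedes it below -/
import Mathlib

section
/- Let E be a complete real inner product space, let f : E → ℝ be differentiable with gradient ∇f, let 0 < μ ≤ G be real numbers, suppose f is μ-strongly convex on E and ∇f is Lipschitz with constant G, and let x⋆ be a global minimizer of f. Then for every x ∈ E and every step size η with 0 < η ≤ 1/G, the single gradient step satisfies f(x − η·∇f(x)) − f(x⋆) ≤ (1 − η μ) · (f(x) − f(x⋆)). -/
/-- A function with gradient `f'` has derivative `⟪f' (x + t • v), v⟫` along the line through `x`
with direction `v`. -/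
theorem HasGradientAt.hasDerivAt_comp_add_smul
    {E : Type*} [NormedAddCommGroup E] [InnerProductSpace ℝ E] [CompleteSpace E]
    {f : E → ℝ} {g x v : E} {t : ℝ} (hf : HasGradientAt f g (x + t • v)) :
    HasDerivAt (fun s : ℝ => f (x + s • v)) (inner ℝ g v) t := by
  have hline : HasDerivAt (fun s : ℝ => x + s • v) v t := by
    simpa using ((hasDerivAt_id t).smul_const v).const_add x
  simpa [Function.comp_def] using hf.hasFDerivAt.comp_hasDerivAt t hline

/-- The descent lemma: a function with `G`-Lipschitz gradient lies below its quadratic upper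
model. -/
theorem le_add_inner_add_of_gradient_lipschitz
    {E : Type*} [NormedAddCommGroup E] [InnerProductSpace ℝ E] [CompleteSpace E]
    {f : E → ℝ} {f' : E → E} (hf : ∀ x, HasGradientAt f (f' x) x) {G : ℝ}
    (hlip : ∀ x y, ‖f' x - f' y‖ ≤ G * ‖x - y‖) (x v : E) :
    f (x + v) ≤ f x + inner ℝ (f' x) v + G / 2 * ‖v‖ ^ 2 := by
  let φ : ℝ → ℝ := fun t => f (x + t • v) - t * inner ℝ (f' x) v - G / 2 * ‖v‖ ^ 2 * t ^ 2
  have hφ (t : ℝ) : HasDerivAt φ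
      (inner ℝ (f' (x + t • v)) v - inner ℝ (f' x) v - G * ‖v‖ ^ 2 * t) t := by
    have h₁ := (hf (x + t • v)).hasDerivAt_comp_add_smul
    have h₂ := (hasDerivAt_id t).mul_const (inner ℝ (f' x) v)
    have h₃ := (hasDerivAt_pow 2 t).const_mul (G / 2 * ‖v‖ ^ 2)
    exact ((h₁.sub h₂).sub h₃).congr_deriv (by norm_num; ring)
  have hanti : AntitoneOn φ (Set.Icc 0 1) := by
    refine antitoneOn_of_deriv_nonpos (convex_Icc 0 1)
      (fun t _ => (hφ t).continuousAt.continuousWithinAt)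
      (fun t _ => (hφ t).differentiableAt.differentiableWithinAt) fun t ht => ?_
    have ht₀ : 0 ≤ t := (interior_subset ht).1
    rw [(hφ t).deriv, ← inner_sub_left, sub_nonpos]
    calc inner ℝ (f' (x + t • v) - f' x) v
        ≤ ‖f' (x + t • v) - f' x‖ * ‖v‖ := real_inner_le_norm _ _
      _ ≤ G * ‖x + t • v - x‖ * ‖v‖ := by gcongr; exact hlip _ _
      _ = G * ‖v‖ ^ 2 * t := by
        rw [add_sub_cancel_left, norm_smul, Real.norm_of_nonneg ht₀]; ring
  have h := hanti (Set.left_mem_Icc.2 zero_le_one) (Set.right_mem_Icc.2 zero_le_one) zero_le_one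
  simp only [φ, one_smul, zero_smul, add_zero] at h
  linarith

/-- A strongly convex function lies above its quadratic lower model. -/
theorem add_inner_add_le_of_strongly_convex
    {E : Type*} [NormedAddCommGroup E] [InnerProductSpace ℝ E] [CompleteSpace E]
    {f : E → ℝ} {g x : E} (hf : HasGradientAt f g x) {μ : ℝ}
    (hconv : ConvexOn ℝ Set.univ (fun x => f x - μ / 2 * ‖x‖ ^ 2)) (v : E) :
    f x + inner ℝ g v + μ / 2 * ‖v‖ ^ 2 ≤ f (x + v) := by
  let φ : ℝ → ℝ := fun t => f (x + t • v) - μ / 2 * ‖x + t • v‖ ^ 2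
  have hφconv : ConvexOn ℝ Set.univ φ := by
    have h := hconv.comp_affineMap (AffineMap.lineMap x (x + v))
    simpa [φ, Function.comp_def, AffineMap.lineMap_apply, add_comm] using h
  have hφ : HasDerivAt φ (inner ℝ g v - μ * inner ℝ x v) 0 := by
    have h₁ : HasDerivAt (fun s : ℝ => f (x + s • v)) (inner ℝ g v) 0 :=
      HasGradientAt.hasDerivAt_comp_add_smul (by simpa using hf)
    have hline : HasDerivAt (fun s : ℝ => x + s • v) v 0 := by
      simpa using ((hasDerivAt_id (0 : ℝ)).smul_const v).const_add x
    exact (h₁.sub (hline.norm_sq.const_mul (μ / 2))).congr_deriv (by simp; ring)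
  have h := hφconv.le_slope_of_hasDerivAt (Set.mem_univ 0) (Set.mem_univ 1) zero_lt_one hφ
  simp only [slope_def_field, φ, one_smul, zero_smul, add_zero, sub_zero, div_one,
    norm_add_sq_real x v] at h
  linarith

/-- The Polyak–Łojasiewicz inequality for strongly convex functions. -/
theorem mul_sub_le_norm_gradient_sq_of_strongly_convex
    {E : Type*} [NormedAddCommGroup E] [InnerProductSpace ℝ E] [CompleteSpace E]
    {f : E → ℝ} {g x : E} (hf : HasGradientAt f g x) {μ : ℝ} (hμ : 0 < μ)
    (hconv : ConvexOn ℝ Set.univ (fun x => f x - μ / 2 * ‖x‖ ^ 2)) (y : E) :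
    2 * μ * (f x - f y) ≤ ‖g‖ ^ 2 := by
  have h := add_inner_add_le_of_strongly_convex hf hconv (y - x)
  rw [add_sub_cancel] at h
  have hsq : 0 ≤ ‖g + μ • (y - x)‖ ^ 2 := sq_nonneg _
  rw [norm_add_sq_real, inner_smul_right, norm_smul, mul_pow, Real.norm_of_nonneg hμ.le] at hsq
  nlinarith

/-- One-step contraction of gradient descent on a `μ`-strongly convex function with
`G`-Lipschitz gradient: for step size `0 < η ≤ 1/G`,
`f(x - η∇f(x)) - f(x⋆) ≤ (1 - ημ)(f(x) - f(x⋆))`. -/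
theorem gradient_descent_one_step_contraction
    {E : Type*} [NormedAddCommGroup E] [InnerProductSpace ℝ E] [CompleteSpace E]
    (f : E → ℝ) (f' : E → E) (hf : ∀ x, HasGradientAt f (f' x) x)
    (μ G : ℝ) (hμ : 0 < μ) (hμG : μ ≤ G)
    (hconv : ConvexOn ℝ Set.univ (fun x => f x - μ / 2 * ‖x‖ ^ 2))
    (hlip : ∀ x y, ‖f' x - f' y‖ ≤ G * ‖x - y‖)
    (xstar : E) (hmin : ∀ x, f xstar ≤ f x) :
    ∀ (x : E) (η : ℝ), 0 < η → η ≤ 1 / G →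
      f (x - η • f' x) - f xstar ≤ (1 - η * μ) * (f x - f xstar) := by
  intro x η hη hηG
  have hηG' : η * G ≤ 1 := (le_div_iff₀ (hμ.trans_le hμG)).1 hηG
  have hdesc := le_add_inner_add_of_gradient_lipschitz hf hlip x (-(η • f' x))
  rw [← sub_eq_add_neg, inner_neg_right, inner_smul_right, real_inner_self_eq_norm_sq, norm_neg,
    norm_smul, mul_pow, Real.norm_of_nonneg hη.le] at hdesc
  have hPL := mul_le_mul_of_nonneg_left
    (mul_sub_le_norm_gradient_sq_of_strongly_convex (hf x) hμ hconv xstar) hη.le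
  have hstep := mul_le_mul_of_nonneg_right hηG' (mul_nonneg hη.le (sq_nonneg ‖f' x‖))
  linarith
end

section
/- Let X be a type, R a positive natural number, and c : X → Fin R a cluster-assignment function. For a finite multiset D over X and elements a, b ∈ X, define for each r ∈ Fin R the count v_r(M) = number of elements x of the multiset M with c(x) = r. Then ∑_{r ∈ Fin R} |v_r(D + {a}) − v_r(D + {b})| ≤ 2, where the counts are compared as integers. -/
/-- ℓ1-sensitivity of the cluster-count (Centroid Coverage) score vector: replacing one
element of the multiset `D` (adding `a` versus adding `b`) changes the vector of cluster
counts by at most `2` in ℓ1 norm. -/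
theorem cluster_counts_l1_sensitivity
    {X : Type*} (R : ℕ) (hR : 0 < R) (c : X → Fin R)
    (D : Multiset X) (a b : X) :
    ∑ r : Fin R,
        |(((D + {a}).countP fun x => c x = r) : ℤ) -
          (((D + {b}).countP fun x => c x = r) : ℤ)| ≤ 2 := by
  calc
    _ ≤ ∑ r : Fin R, ((if c a = r then 1 else 0) + (if c b = r then 1 else 0) : ℤ) := by
      refine Finset.sum_le_sum fun r _ => ?_
      by_cases ha : c a = r <;> by_cases hb : c b = r <;>
        simp [← Multiset.cons_zero, ha, hb]
    _ ≤ 2 := by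
      simp [Finset.sum_add_distrib]
end

section
/- Let (Ω, ℱ) be a measurable space, let P and Q be probability measures on Ω with P absolutely continuous with respect to Q, let α > 1 and ε ≥ 0 be real numbers, and let δ ∈ (0, 1). If ∫ (dP/dQ)^α dQ ≤ exp((α − 1)·ε), then for every measurable set E, P(E) ≤ exp(ε + log(1/δ)/(α − 1)) · Q(E) + δ. -/
open MeasureTheory

/-- Truncation at level `t`: above it, `r` is dominated by `t ^ (1 - α) * r ^ α`. -/
theorem ENNReal.le_add_rpow_one_sub_mul_rpow {α : ℝ} (hα : 1 < α) {t : ENNReal}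
    (ht0 : t ≠ 0) (ht : t ≠ ⊤) (r : ENNReal) : r ≤ t + t ^ (1 - α) * r ^ α := by
  rcases le_total r t with h | h
  · exact h.trans le_self_add
  refine le_add_left ?_
  have hr0 : r ≠ 0 := fun h0 => ht0 (le_zero_iff.mp (h0 ▸ h))
  rcases eq_or_ne r ⊤ with rfl | hr
  · rw [ENNReal.top_rpow_of_pos (by linarith), ENNReal.mul_top]
    exact (ENNReal.rpow_pos (pos_iff_ne_zero.mpr ht0) ht).ne'
  calc r = r ^ (1 - α) * r ^ α := by
        rw [← ENNReal.rpow_add _ _ hr0 hr, sub_add_cancel, ENNReal.rpow_one]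
    _ ≤ t ^ (1 - α) * r ^ α := by
        gcongr ?_ * _
        rw [← neg_sub, ENNReal.rpow_neg, ENNReal.rpow_neg, ENNReal.inv_le_inv]
        exact ENNReal.rpow_le_rpow h (by linarith)

/-- Bound on `P E` obtained by truncating the density of `P` with respect to `Q` at level `t`. -/
theorem MeasureTheory.Measure.AbsolutelyContinuous.measure_le_mul_add_lintegral_rnDeriv_rpow
    {Ω : Type*} [MeasurableSpace Ω] {P Q : Measure Ω} [SigmaFinite P] [SigmaFinite Q]
    (hPQ : P ≪ Q) {α : ℝ} (hα : 1 < α) {t : ENNReal} (ht0 : t ≠ 0) (ht : t ≠ ⊤) (E : Set Ω) :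
    P E ≤ t * Q E + t ^ (1 - α) * ∫⁻ ω, P.rnDeriv Q ω ^ α ∂Q :=
  calc P E = ∫⁻ ω in E, P.rnDeriv Q ω ∂Q := (Measure.setLIntegral_rnDeriv hPQ E).symm
    _ ≤ ∫⁻ ω in E, (t + t ^ (1 - α) * P.rnDeriv Q ω ^ α) ∂Q :=
        lintegral_mono fun _ => ENNReal.le_add_rpow_one_sub_mul_rpow hα ht0 ht _
    _ = t * Q E + t ^ (1 - α) * ∫⁻ ω in E, P.rnDeriv Q ω ^ α ∂Q := by
        rw [lintegral_add_left measurable_const, setLIntegral_const,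
          lintegral_const_mul _ ((Measure.measurable_rnDeriv P Q).pow_const α)]
    _ ≤ t * Q E + t ^ (1 - α) * ∫⁻ ω, P.rnDeriv Q ω ^ α ∂Q := by
        gcongr
        exact Measure.restrict_le_self

/-- RDP-to-DP conversion at the level of a single pair of output distributions: if the
`α`-th moment of the likelihood ratio is at most `exp((α-1)ε)`, then for every measurable
set `E`, `P(E) ≤ exp(ε + log(1/δ)/(α-1)) Q(E) + δ`. -/
theorem rdp_to_dp
    {Ω : Type*} [MeasurableSpace Ω] (P Q : Measure Ω)
    [IsProbabilityMeasure P] [IsProbabilityMeasure Q]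
    (hPQ : P ≪ Q) (α ε δ : ℝ) (hα : 1 < α) (hε : 0 ≤ ε) (hδ0 : 0 < δ) (hδ1 : δ < 1)
    (hmoment : ∫⁻ ω, P.rnDeriv Q ω ^ α ∂Q ≤ ENNReal.ofReal (Real.exp ((α - 1) * ε))) :
    ∀ E : Set Ω, MeasurableSet E →
      P E ≤ ENNReal.ofReal (Real.exp (ε + Real.log (1 / δ) / (α - 1))) * Q E +
        ENNReal.ofReal δ := by
  intro E _
  refine (hPQ.measure_le_mul_add_lintegral_rnDeriv_rpow hα
    (t := ENNReal.ofReal (Real.exp (ε + Real.log (1 / δ) / (α - 1))))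
    (ENNReal.ofReal_pos.mpr (Real.exp_pos _)).ne' ENNReal.ofReal_ne_top E).trans ?_
  gcongr
  refine (mul_le_mul_right hmoment _).trans_eq ?_
  rw [ENNReal.ofReal_rpow_of_pos (Real.exp_pos _), ← ENNReal.ofReal_mul (by positivity),
    ← Real.exp_mul, ← Real.exp_add]
  have hα' : α - 1 ≠ 0 := by linarith
  have h : (ε + Real.log (1 / δ) / (α - 1)) * (1 - α) + (α - 1) * ε = Real.log δ := by
    rw [one_div, Real.log_inv]
    field_simp
    ring
  rw [h, Real.exp_log hδ0]
end

section
/- Let (Ω, ℱ) be a measurable space, let P and Q be probability measures on Ω with P absolutely continuous with respect to Q, let σ > 0, γ > 0 be reals, and let δ ∈ (0, 1) with γ ≤ σ·√(log(1/δ)/6). Set α₀ = 1 + (σ/γ)·√(log(1/δ)/24). If ∫ (dP/dQ)^{α₀} dQ ≤ exp((α₀ − 1) · 24·γ²·α₀/σ²), then for every measurable set E, P(E) ≤ exp(8·(γ/σ)·√(6·log(1/δ))) · Q(E) + δ. -/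
open MeasureTheory

/-- Pointwise splitting behind the conversion of moment bounds into tail bounds. -/
theorem ENNReal.le_ofReal_exp_add_mul_rpow (x : ENNReal) (ε : ℝ) {α : ℝ} (hα : 1 < α) :
    x ≤ ENNReal.ofReal (Real.exp ε) +
      ENNReal.ofReal (Real.exp (-((α - 1) * ε))) * x ^ α := by
  rcases le_or_gt x (ENNReal.ofReal (Real.exp ε)) with h | h
  · exact h.trans le_self_add
  refine le_trans ?_ le_add_self
  induction x with
  | top =>
    rw [ENNReal.top_rpow_of_pos (by linarith), ENNReal.mul_top]
    simp [Real.exp_pos]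
  | coe r =>
    have hr : Real.exp ε < r := by
      rwa [← ENNReal.ofReal_coe_nnreal, ENNReal.ofReal_lt_ofReal_iff_of_nonneg (Real.exp_pos ε).le]
        at h
    have hr0 : (0 : ℝ) < r := (Real.exp_pos ε).trans hr
    have hlog : ε ≤ Real.log r := (Real.le_log_iff_exp_le hr0).2 hr.le
    rw [← ENNReal.ofReal_coe_nnreal, ENNReal.ofReal_rpow_of_pos hr0,
      ← ENNReal.ofReal_mul (Real.exp_pos _).le]
    refine ENNReal.ofReal_le_ofReal ?_
    rw [Real.rpow_def_of_pos hr0, ← Real.exp_add, ← Real.log_le_iff_le_exp hr0]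
    nlinarith

/-- Conversion of a Rényi moment bound of order `α` into an `(ε, δ)`-bound. -/
theorem MeasureTheory.Measure.le_exp_mul_add_of_lintegral_rnDeriv_rpow_le
    {Ω : Type*} [MeasurableSpace Ω] {P Q : Measure Ω} [SigmaFinite P] [SigmaFinite Q]
    (hPQ : P ≪ Q) {α ρ ε δ : ℝ} (hα : 1 < α) (hδ : 0 < δ)
    (hmoment : ∫⁻ ω, P.rnDeriv Q ω ^ α ∂Q ≤ ENNReal.ofReal (Real.exp ((α - 1) * ρ)))
    (hε : (α - 1) * ρ + Real.log (1 / δ) ≤ (α - 1) * ε) (E : Set Ω) :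
    P E ≤ ENNReal.ofReal (Real.exp ε) * Q E + ENNReal.ofReal δ := by
  set c := ENNReal.ofReal (Real.exp (-((α - 1) * ε)))
  calc P E = ∫⁻ ω in E, P.rnDeriv Q ω ∂Q := (Measure.setLIntegral_rnDeriv hPQ E).symm
    _ ≤ ∫⁻ ω in E, (ENNReal.ofReal (Real.exp ε) + c * P.rnDeriv Q ω ^ α) ∂Q :=
        lintegral_mono fun ω => ENNReal.le_ofReal_exp_add_mul_rpow _ ε hα
    _ = ENNReal.ofReal (Real.exp ε) * Q E + c * ∫⁻ ω in E, P.rnDeriv Q ω ^ α ∂Q := by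
        rw [lintegral_add_left measurable_const, setLIntegral_const,
          lintegral_const_mul' _ _ ENNReal.ofReal_ne_top]
    _ ≤ ENNReal.ofReal (Real.exp ε) * Q E +
          c * ENNReal.ofReal (Real.exp ((α - 1) * ρ)) := by
        gcongr
        exact (setLIntegral_le_lintegral E _).trans hmoment
    _ ≤ ENNReal.ofReal (Real.exp ε) * Q E + ENNReal.ofReal δ := by
        gcongr
        rw [← ENNReal.ofReal_mul (Real.exp_pos _).le, ← Real.exp_add]
        refine ENNReal.ofReal_le_ofReal ?_
        rw [← Real.le_log_iff_exp_le hδ]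
        rw [one_div, Real.log_inv] at hε
        linarith

/-- Measure-theoretic core of the ECOS privacy bound: an
`(α₀, 24γ²α₀/σ²)`-RDP moment bound at the optimal order
`α₀ = 1 + (σ/γ)√(log(1/δ)/24)` implies the `(ε, δ)`-DP inequality with
`ε = 8(γ/σ)√(6 log(1/δ))`. -/
theorem ecos_rdp_to_dp
    {Ω : Type*} [MeasurableSpace Ω] (P Q : Measure Ω)
    [IsProbabilityMeasure P] [IsProbabilityMeasure Q]
    (hPQ : P ≪ Q) (σ γ δ : ℝ) (hσ : 0 < σ) (hγ : 0 < γ)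
    (hδ0 : 0 < δ) (hδ1 : δ < 1)
    (hγσ : γ ≤ σ * Real.sqrt (Real.log (1 / δ) / 6))
    (α₀ : ℝ) (hα₀ : α₀ = 1 + (σ / γ) * Real.sqrt (Real.log (1 / δ) / 24))
    (hmoment : ∫⁻ ω, P.rnDeriv Q ω ^ α₀ ∂Q ≤
      ENNReal.ofReal (Real.exp ((α₀ - 1) * (24 * γ ^ 2 * α₀ / σ ^ 2)))) :
    ∀ E : Set Ω, MeasurableSet E →
      P E ≤ ENNReal.ofReal (Real.exp (8 * (γ / σ) * Real.sqrt (6 * Real.log (1 / δ)))) * Q E +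
        ENNReal.ofReal δ := by
  intro E _
  have hL : 0 < Real.log (1 / δ) := Real.log_pos (by rw [lt_div_iff₀ hδ0]; linarith)
  set L := Real.log (1 / δ) with hLdef
  set s := Real.sqrt (L / 24) with hs
  have hs0 : 0 < s := Real.sqrt_pos.2 (by positivity)
  have hsL : L = 24 * s ^ 2 := by rw [hs, Real.sq_sqrt (by positivity)]; ring
  have h6 : Real.sqrt (L / 6) = 2 * s := by
    rw [hsL, show 24 * s ^ 2 / 6 = (2 * s) ^ 2 by ring, Real.sqrt_sq (by positivity)]
  have h12 : Real.sqrt (6 * L) = 12 * s := by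
    rw [hsL, show 6 * (24 * s ^ 2) = (12 * s) ^ 2 by ring, Real.sqrt_sq (by positivity)]
  rw [h6] at hγσ
  have hα : α₀ - 1 = σ / γ * s := by rw [hα₀]; ring
  refine Measure.le_exp_mul_add_of_lintegral_rnDeriv_rpow_le hPQ ?_ hδ0 hmoment ?_ E
  · have : 0 < σ / γ * s := by positivity
    linarith
  · rw [← hLdef, h12, hα, hα₀, hsL]
    have hle : γ / σ ≤ 2 * s := by rw [div_le_iff₀ hσ]; linarith
    have hcost : σ / γ * s * (24 * γ ^ 2 * (1 + σ / γ * s) / σ ^ 2) + 24 * s ^ 2 =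
        24 * s * (γ / σ) + 48 * s ^ 2 := by
      field_simp
      ring
    have hbudget : σ / γ * s * (8 * (γ / σ) * (12 * s)) = 96 * s ^ 2 := by
      field_simp
      ring
    rw [hcost, hbudget]
    nlinarith
end
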